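/- Let B_alpha and B_beta be nonempty subsets of the reals, let u_alpha, u_beta, b, G_alpha, G_beta be real numbers with G_alpha = G_beta and u_alpha < u_beta, and suppose u_alpha lies in the closure of the convex hull of B_alpha and u_beta lies in the closure of the convex hull of B_beta. If for every m in B_alpha, (m - u_alpha - b)^2 + G_alpha < (m - u_beta - b)^2 + G_beta, and for every m in B_beta, (m - u_beta - b)^2 + G_beta < (m - u_alpha - b)^2 + G_alpha, then u_beta - u_alpha >= 2*|b|. -/

import Mathlib

/-- A closed convex set containing `s` contains the closure of the convex hull of `s`. -/
theorem closure_convexHull_subset {s t : Set ℝ} (hst : s ⊆ t) (ht : Convex ℝ t)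
    (htc : IsClosed t) : closure (convexHull ℝ s) ⊆ t :=
  closure_minimal (convexHull_min hst ht) htc

theorem stmt_1 (B_alpha B_beta : Set ℝ) (hBa : B_alpha.Nonempty) (hBb : B_beta.Nonempty)
    (u_alpha u_beta b G_alpha G_beta : ℝ)
    (hG : G_alpha = G_beta) (hu : u_alpha < u_beta)
    (hua : u_alpha ∈ closure (convexHull ℝ B_alpha))
    (hub : u_beta ∈ closure (convexHull ℝ B_beta))
    (h1 : ∀ m ∈ B_alpha, (m - u_alpha - b)^2 + G_alpha < (m - u_beta - b)^2 + G_beta)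
    (h2 : ∀ m ∈ B_beta, (m - u_beta - b)^2 + G_beta < (m - u_alpha - b)^2 + G_alpha) :
    u_beta - u_alpha ≥ 2 * |b| := by
  have ha : u_alpha ≤ (u_alpha + u_beta) / 2 + b :=
    closure_convexHull_subset (t := Set.Iic ((u_alpha + u_beta) / 2 + b))
      (fun m hm => Set.mem_Iic.2 (by nlinarith [h1 m hm])) (convex_Iic _) isClosed_Iic hua
  have hb : (u_alpha + u_beta) / 2 + b ≤ u_beta :=
    closure_convexHull_subset (t := Set.Ici ((u_alpha + u_beta) / 2 + b))
      (fun m hm => Set.mem_Ici.2 (by nlinarith [h2 m hm])) (convex_Ici _) isClosed_Ici hub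
  have habs : |b| ≤ (u_beta - u_alpha) / 2 := abs_le.2 ⟨by linarith, by linarith⟩
  linarith
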